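/- arXiv:2001.04512 — 4 statements merged into one kernel-verified Lean document; each statement's English description precedes it below -/
import Mathlib

section
/- In the crossing-data model with a core structure, the rational number λ̃ − (1/2) · Σ_{unordered pairs {i,j}} m i j is an integer. Consequently, for every integer s₋, the complex number I^(2·(λ̃ − s₋ − (1/2)·Σ m i j)) (where I is the imaginary unit, so that (−1)^(1/2) = I) lies in {−1, 1}. -/
open Finset

/-- The number of mixed classical crossings between components `i` and `j`. -/
def mCount {ι : Type*} (P N : ι → ι → ℕ) (i j : ι) : ℕ := P i j + N i j

/-- The linking number `Lk i j = (P i j - N i j)/2`, as a complex number. -/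
noncomputable def linking {ι : Type*} (P N : ι → ι → ℕ) (i j : ι) : ℂ :=
  ((P i j : ℂ) - (N i j : ℂ)) / 2

/-- The component-to-component parity `π i j = (m i j) mod 2`. -/
def ccParity {ι : Type*} (P N : ι → ι → ℕ) (i j : ι) : ℕ := (P i j + N i j) % 2

/-- The component parity function `p i j`: `0` if `i` and `j` lie in a common core,
`1` otherwise. -/
def compParity {ι : Type*} [DecidableEq ι] (cores : Finset (Finset ι)) (i j : ι) : ℕ :=
  if ∃ C ∈ cores, i ∈ C ∧ j ∈ C then 0 else 1

/-- The modified linking number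
`L̃k i j = (-1)^(p i j * (Lk i j + π i j / 2)) * Lk i j`,
where `(-1)^e` is the principal complex power (so `(-1)^(1/2) = I`). -/
noncomputable def modLinking {ι : Type*} [DecidableEq ι] (P N : ι → ι → ℕ)
    (cores : Finset (Finset ι)) (i j : ι) : ℂ :=
  (-1 : ℂ) ^ ((compParity cores i j : ℂ) *
      (linking P N i j + (ccParity P N i j : ℂ) / 2)) * linking P N i j

/-- `λ̃`: the sum over unordered pairs of distinct components of the modified
linking numbers (each unordered pair is counted twice in `offDiag`, whence the
division by `2`). -/
noncomputable def lamTilde {ι : Type*} [Fintype ι] [DecidableEq ι] (P N : ι → ι → ℕ)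
    (cores : Finset (Finset ι)) : ℂ :=
  (∑ p ∈ (univ : Finset ι).offDiag, modLinking P N cores p.1 p.2) / 2

/-- A symmetric integer function has an even sum over ordered pairs of distinct elements. -/
theorem even_sum_offDiag_of_symm {ι : Type*} [DecidableEq ι] (s : Finset ι)
    (f : ι → ι → ℤ) (hf : ∀ i j, f i j = f j i) :
    Even (∑ p ∈ s.offDiag, f p.1 p.2) := by
  rw [even_iff_two_dvd, ← Nat.cast_ofNat, ← ZMod.intCast_zmod_eq_zero_iff_dvd _ 2, Int.cast_sum]
  refine Finset.sum_involution (fun p _ => p.swap) ?_ ?_ ?_ ?_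
  · rintro ⟨i, j⟩ -
    simp only [Prod.swap, hf j i]
    exact CharTwo.add_self_eq_zero _
  · rintro ⟨i, j⟩ hp - h
    simp only [Finset.mem_offDiag, Prod.swap, Prod.mk.injEq] at hp h
    exact hp.2.2 h.2
  · rintro ⟨i, j⟩ hp
    simp only [Finset.mem_offDiag, Prod.swap] at hp ⊢
    exact ⟨hp.2.1, hp.1, hp.2.2.symm⟩
  · intro p _
    exact p.swap_swap

/-- The exponent in the modified linking number is an integer. -/
theorem exists_int_eq_exponent {ι : Type*} [DecidableEq ι] (P N : ι → ι → ℕ)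
    (cores : Finset (Finset ι)) (i j : ι) :
    ∃ e : ℤ, (compParity cores i j : ℂ) *
      (linking P N i j + (ccParity P N i j : ℂ) / 2) = (e : ℂ) := by
  obtain ⟨c, hc⟩ : ∃ c : ℤ, (P i j : ℤ) - N i j + ((P i j + N i j) % 2 : ℕ) = 2 * c :=
    ⟨((P i j : ℤ) - N i j + ((P i j + N i j) % 2 : ℕ)) / 2, by omega⟩
  refine ⟨compParity cores i j * c, ?_⟩
  have hcast := congrArg (Int.cast : ℤ → ℂ) hc
  simp only [Int.cast_add, Int.cast_sub, Int.cast_mul, Int.cast_natCast, Int.cast_ofNat] at hcast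
  simp only [linking, ccParity, Int.cast_mul, Int.cast_natCast]
  linear_combination (compParity cores i j : ℂ) / 2 * hcast

/-- The modified linking number differs from half the mixed-crossing count by an integer. -/
theorem exists_int_modLinking_sub {ι : Type*} [DecidableEq ι] (P N : ι → ι → ℕ)
    (cores : Finset (Finset ι)) (i j : ι) :
    ∃ k : ℤ, modLinking P N cores i j - (mCount P N i j : ℂ) / 2 = (k : ℂ) := by
  obtain ⟨e, he⟩ := exists_int_eq_exponent P N cores i j
  rw [modLinking, he, Complex.cpow_intCast]
  rcases Int.even_or_odd e with h | h
  · refine ⟨-N i j, ?_⟩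
    rw [h.neg_one_zpow]
    simp only [linking, mCount]
    push_cast
    ring
  · refine ⟨-P i j, ?_⟩
    rw [h.neg_one_zpow]
    simp only [linking, mCount]
    push_cast
    ring

theorem modLinking_symm {ι : Type*} [DecidableEq ι] {P N : ι → ι → ℕ}
    (cores : Finset (Finset ι)) (hP : ∀ i j, P i j = P j i) (hN : ∀ i j, N i j = N j i)
    (i j : ι) : modLinking P N cores i j = modLinking P N cores j i := by
  simp only [modLinking, linking, ccParity, compParity, hP i j, hN i j,
    and_comm (a := i ∈ _)]

theorem I_cpow_two_mul_intCast_mem (n : ℤ) :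
    Complex.I ^ (2 * (n : ℂ)) ∈ ({-1, 1} : Set ℂ) := by
  have h : (2 * (n : ℂ)) = ((2 * n : ℤ) : ℂ) := by push_cast; rfl
  rw [h, Complex.cpow_intCast, zpow_mul, zpow_ofNat, Complex.I_sq]
  rcases Int.even_or_odd n with h | h <;> simp [h.neg_one_zpow]

/-- `λ̃ - (1/2) * Σ_{unordered pairs} m i j` is an integer; consequently, for every
integer `sNeg`, the complex number `I ^ (2 * (λ̃ - sNeg - (1/2) * Σ m))` lies in `{-1, 1}`. -/
theorem lamTilde_sub_half_mixed_int {ι : Type*} [Fintype ι] [DecidableEq ι]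
    (P N : ι → ι → ℕ) (cores : Finset (Finset ι))
    (hPsymm : ∀ i j, P i j = P j i) (hNsymm : ∀ i j, N i j = N j i)
    (hPdiag : ∀ i : ι, P i i = 0) (hNdiag : ∀ i : ι, N i i = 0)
    (hdisj : ∀ C ∈ cores, ∀ C' ∈ cores, C ≠ C' → Disjoint C C')
    (hcores : ∀ C ∈ cores, ∀ i ∈ C, Even (∑ j ∈ C, mCount P N i j)) :
    (∃ k : ℤ, lamTilde P N cores -
        ((∑ p ∈ (univ : Finset ι).offDiag, (mCount P N p.1 p.2 : ℂ)) / 2) / 2 = (k : ℂ)) ∧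
    ∀ sNeg : ℤ,
      Complex.I ^ (2 * (lamTilde P N cores - (sNeg : ℂ) -
          ((∑ p ∈ (univ : Finset ι).offDiag, (mCount P N p.1 p.2 : ℂ)) / 2) / 2))
        ∈ ({-1, 1} : Set ℂ) := by
  have hint : ∃ k : ℤ, lamTilde P N cores -
      ((∑ p ∈ (univ : Finset ι).offDiag, (mCount P N p.1 p.2 : ℂ)) / 2) / 2 = (k : ℂ) := by
    choose f hf using exists_int_modLinking_sub P N cores
    have hsymm : ∀ i j, f i j = f j i := fun i j => by
      have h : (f i j : ℂ) = f j i := by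
        rw [← hf i j, ← hf j i, modLinking_symm cores hPsymm hNsymm i j, mCount, mCount,
          hPsymm i j, hNsymm i j]
      exact_mod_cast h
    obtain ⟨k, hk⟩ := even_sum_offDiag_of_symm univ f hsymm
    refine ⟨k, ?_⟩
    have hcast := congrArg (Int.cast : ℤ → ℂ) hk
    simp only [Int.cast_sum, Int.cast_add, ← hf, Finset.sum_sub_distrib,
      ← Finset.sum_div] at hcast
    rw [lamTilde]
    linear_combination hcast / 2
  refine ⟨hint, fun sNeg => ?_⟩
  obtain ⟨k, hk⟩ := hint
  rw [sub_right_comm, hk, ← Int.cast_sub]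
  exact I_cpow_two_mul_intCast_mem _
end

section
/- In the crossing-data model with a core structure whose cores are each even, interpret (−1)^λ̃ as I^(2λ̃), where I is the imaginary unit of ℂ and 2λ̃ is an integer. Let T be any subset of the components and let (P′, N′) be obtained from (P, N) by reversing the orientations of all components in T, i.e. P′ i j = N i j and N′ i j = P i j whenever exactly one of i, j lies in T, and P′ i j = P i j, N′ i j = N i j otherwise. Then I^(2·λ̃(P,N)) = I^(2·λ̃(P′,N′)); that is, the sign (−1)^λ̃ is independent of the choice of orientation. -/
open Finset

theorem modLinking_of_core {ι : Type*} [DecidableEq ι] (P N : ι → ι → ℕ)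
    {cores : Finset (Finset ι)} {i j : ι} (h : ∃ C ∈ cores, i ∈ C ∧ j ∈ C) :
    modLinking P N cores i j = linking P N i j := by
  simp [modLinking, compParity, h]

theorem modLinking_of_not_core {ι : Type*} [DecidableEq ι] (P N : ι → ι → ℕ)
    {cores : Finset (Finset ι)} {i j : ι} (h : ¬ ∃ C ∈ cores, i ∈ C ∧ j ∈ C) {k : ℤ}
    (hk : (P i j : ℤ) - N i j + ((P i j + N i j) % 2 : ℕ) = 2 * k) :
    modLinking P N cores i j = (-1 : ℂ) ^ k * linking P N i j := by
  have hk' : (P i j : ℂ) - N i j + ((P i j + N i j) % 2 : ℕ) = 2 * k := by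
    simpa [-Int.natCast_emod, -Int.natCast_mod] using congrArg (Int.cast : ℤ → ℂ) hk
  have he : (compParity cores i j : ℂ) * (linking P N i j + (ccParity P N i j : ℂ) / 2) =
      (k : ℂ) := by
    rw [compParity, if_neg h, linking, ccParity]
    push_cast at hk' ⊢
    linear_combination hk' / 2
  rw [modLinking, he, Complex.cpow_intCast]

theorem modLinking_comm {ι : Type*} [DecidableEq ι] {P N : ι → ι → ℕ}
    (hP : ∀ i j, P i j = P j i) (hN : ∀ i j, N i j = N j i)
    (cores : Finset (Finset ι)) (i j : ι) :
    modLinking P N cores i j = modLinking P N cores j i := by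
  have hc : compParity cores i j = compParity cores j i := by
    simp only [compParity, and_comm (a := i ∈ _)]
  simp only [modLinking, linking, ccParity, hc, hP i j, hN i j]

/-- Exchanging positive and negative crossings changes the modified linking number by an integer,
which is even outside the cores and has the parity of the crossing count inside them. -/
theorem exists_modLinking_sub_swap {ι : Type*} [DecidableEq ι] (P N : ι → ι → ℕ)
    (cores : Finset (Finset ι)) (i j : ι) :
    ∃ z : ℤ, modLinking P N cores i j - modLinking N P cores i j = z ∧
      (z : ZMod 2) = if ∃ C ∈ cores, i ∈ C ∧ j ∈ C then (mCount P N i j : ZMod 2) else 0 := by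
  by_cases h : ∃ C ∈ cores, i ∈ C ∧ j ∈ C
  · refine ⟨P i j - N i j, ?_, ?_⟩
    · rw [modLinking_of_core P N h, modLinking_of_core N P h, linking, linking]
      push_cast
      ring
    · rw [if_pos h, mCount]
      push_cast
      rw [CharTwo.sub_eq_add]
  · rw [if_neg h]
    rcases Nat.even_or_odd (P i j + N i j) with hm | hm
    · obtain ⟨k, hk⟩ : ∃ k : ℤ, (P i j : ℤ) - N i j = 2 * k :=
        ⟨((P i j : ℤ) - N i j) / 2, by have := Nat.even_iff.1 hm; omega⟩
      have hkC : (P i j : ℂ) - N i j = 2 * k := by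
        simpa using congrArg (Int.cast : ℤ → ℂ) hk
      have h1 := modLinking_of_not_core P N h (k := k) (by have := Nat.even_iff.1 hm; omega)
      have h2 := modLinking_of_not_core N P h (k := -k) (by have := Nat.even_iff.1 hm; omega)
      have hs : ((-1 : ℂ) ^ (-k)) = (-1) ^ k := by
        rw [← inv_zpow', inv_neg_one]
      have hl1 : linking P N i j = k := by rw [linking, hkC]; ring
      have hl2 : linking N P i j = -k := by rw [linking]; linear_combination -hkC / 2
      rw [h1, h2, hs, hl1, hl2]
      rcases Int.even_or_odd k with he | ho
      · refine ⟨2 * k, ?_, ZMod.intCast_eq_zero_iff_even.2 (even_two_mul _)⟩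
        rw [he.neg_one_zpow]; push_cast; ring
      · refine ⟨2 * -k, ?_, ZMod.intCast_eq_zero_iff_even.2 (even_two_mul _)⟩
        rw [ho.neg_one_zpow]; push_cast; ring
    · obtain ⟨k, hk⟩ : ∃ k : ℤ, (P i j : ℤ) - N i j + 1 = 2 * k :=
        ⟨((P i j : ℤ) - N i j + 1) / 2, by have := Nat.odd_iff.1 hm; omega⟩
      have h1 := modLinking_of_not_core P N h (k := k) (by have := Nat.odd_iff.1 hm; omega)
      have h2 := modLinking_of_not_core N P h (k := 1 - k) (by have := Nat.odd_iff.1 hm; omega)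
      have hs : ((-1 : ℂ) ^ (1 - k)) = -(-1) ^ k := by
        rw [sub_eq_add_neg, zpow_add₀ (by norm_num), ← inv_zpow', inv_neg_one, zpow_one,
          neg_one_mul]
      refine ⟨0, ?_, by simp⟩
      rw [h1, h2, hs, linking, linking]
      push_cast
      ring

theorem sum_product_self_eq_zero_of_symm {ι R : Type*} [DecidableEq ι] [Ring R] [CharP R 2]
    {f : ι → ι → R} (hf : ∀ i j, f i j = f j i) (hd : ∀ i, f i i = 0) (T : Finset ι) :
    ∑ i ∈ T, ∑ j ∈ T, f i j = 0 := by
  rw [← sum_product']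
  refine sum_involution (fun x _ => x.swap) ?_ ?_ ?_ ?_
  · rintro ⟨i, j⟩ -
    simp [hf j i, CharTwo.add_self_eq_zero]
  · rintro ⟨i, j⟩ - hne heq
    simp only [Prod.swap_prod_mk, Prod.mk.injEq] at heq
    exact hne (by rw [heq.1, hd])
  · rintro ⟨i, j⟩ hx
    simpa [and_comm] using hx
  · rintro ⟨i, j⟩ -
    rfl

/-- Within even cores, the number of mixed crossings across any cut is even. -/
theorem sum_core_cut_eq_zero {ι : Type*} [Fintype ι] [DecidableEq ι]
    {P N : ι → ι → ℕ} {cores : Finset (Finset ι)}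
    (hPsymm : ∀ i j, P i j = P j i) (hNsymm : ∀ i j, N i j = N j i)
    (hPdiag : ∀ i : ι, P i i = 0) (hNdiag : ∀ i : ι, N i i = 0)
    (hdisj : ∀ C ∈ cores, ∀ C' ∈ cores, C ≠ C' → Disjoint C C')
    (hcores : ∀ C ∈ cores, ∀ i ∈ C, Even (∑ j ∈ C, mCount P N i j))
    (T : Finset ι) :
    ∑ i ∈ T, ∑ j ∈ Tᶜ,
      (if ∃ C ∈ cores, i ∈ C ∧ j ∈ C then (mCount P N i j : ZMod 2) else 0) = 0 := by
  set f : ι → ι → ZMod 2 := fun i j =>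
    if ∃ C ∈ cores, i ∈ C ∧ j ∈ C then (mCount P N i j : ZMod 2) else 0 with hf
  have hrow : ∀ i, ∑ j, f i j = 0 := by
    intro i
    by_cases hi : ∃ C ∈ cores, i ∈ C
    · obtain ⟨C, hC, hiC⟩ := hi
      have hiff : ∀ j, (∃ C ∈ cores, i ∈ C ∧ j ∈ C) ↔ j ∈ C := by
        refine fun j => ⟨?_, fun hj => ⟨C, hC, hiC, hj⟩⟩
        rintro ⟨C', hC', hiC', hj⟩
        by_contra hjC
        have hne : C ≠ C' := fun h => hjC (h ▸ hj)
        exact disjoint_left.1 (hdisj C hC C' hC' hne) hiC hiC'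
      simp only [hf, hiff, sum_ite_mem, univ_inter]
      rw [← Nat.cast_sum]
      exact (ZMod.natCast_eq_zero_iff_even).2 (hcores C hC i hiC)
    · refine sum_eq_zero fun j _ => if_neg ?_
      rintro ⟨C, hC, hiC, -⟩
      exact hi ⟨C, hC, hiC⟩
  have hT : ∑ i ∈ T, ∑ j ∈ T, f i j = 0 := by
    refine sum_product_self_eq_zero_of_symm (fun i j => ?_) (fun i => ?_) T
    · simp only [hf, mCount, hPsymm i j, hNsymm i j, and_comm]
    · simp [hf, mCount, hPdiag, hNdiag]
  have hall : ∑ i ∈ T, ∑ j, f i j = 0 := sum_eq_zero fun i _ => hrow i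
  simp_rw [← sum_add_sum_compl T, sum_add_distrib, hT, zero_add] at hall
  exact hall

theorem sum_offDiag_eq_two_mul_sum_cut {ι R : Type*} [Fintype ι] [DecidableEq ι] [CommRing R]
    {d : ι → ι → R} (hd : ∀ i j, d i j = d j i) (T : Finset ι)
    (hz : ∀ i j, (i ∈ T ↔ j ∈ T) → d i j = 0) :
    ∑ p ∈ (univ : Finset ι).offDiag, d p.1 p.2 = 2 * ∑ i ∈ T, ∑ j ∈ Tᶜ, d i j := by
  have h1 : ∑ p ∈ (univ : Finset ι).offDiag, d p.1 p.2 = ∑ i, ∑ j, d i j := by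
    rw [← sum_product', univ_product_univ]
    refine sum_subset (subset_univ _) ?_
    rintro ⟨i, j⟩ - hx
    obtain rfl : i = j := by simpa using hx
    exact hz i i Iff.rfl
  have h2 : ∑ i ∈ T, ∑ j ∈ T, d i j = 0 :=
    sum_eq_zero fun i hi => sum_eq_zero fun j hj => hz i j (by simp [hi, hj])
  have h3 : ∑ i ∈ Tᶜ, ∑ j ∈ Tᶜ, d i j = 0 :=
    sum_eq_zero fun i hi => sum_eq_zero fun j hj =>
      hz i j (by simp [mem_compl.1 hi, mem_compl.1 hj])
  have h4 : ∑ i ∈ Tᶜ, ∑ j ∈ T, d i j = ∑ i ∈ T, ∑ j ∈ Tᶜ, d i j := by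
    rw [sum_comm]
    exact sum_congr rfl fun i _ => sum_congr rfl fun j _ => hd j i
  rw [h1, ← sum_add_sum_compl T]
  simp_rw [← sum_add_sum_compl T (fun j => d _ j), sum_add_distrib, h2, h3, h4]
  ring

/-- The sign `(-1)^λ̃`, interpreted as `I ^ (2λ̃)`, is independent of the choice of
orientation: reversing the orientations of all components in a set `T` (swapping
`P i j` and `N i j` whenever exactly one of `i`, `j` lies in `T`) does not change
`I ^ (2λ̃)`. -/
theorem sign_lamTilde_orientation_independent {ι : Type*} [Fintype ι] [DecidableEq ι]
    (P N : ι → ι → ℕ) (cores : Finset (Finset ι))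
    (hPsymm : ∀ i j, P i j = P j i) (hNsymm : ∀ i j, N i j = N j i)
    (hPdiag : ∀ i : ι, P i i = 0) (hNdiag : ∀ i : ι, N i i = 0)
    (hdisj : ∀ C ∈ cores, ∀ C' ∈ cores, C ≠ C' → Disjoint C C')
    (hcores : ∀ C ∈ cores, ∀ i ∈ C, Even (∑ j ∈ C, mCount P N i j))
    (T : Finset ι) :
    Complex.I ^ (2 * lamTilde P N cores) =
      Complex.I ^ (2 * lamTilde
        (fun i j => if (i ∈ T ∧ j ∉ T) ∨ (j ∈ T ∧ i ∉ T) then N i j else P i j)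
        (fun i j => if (i ∈ T ∧ j ∉ T) ∨ (j ∈ T ∧ i ∉ T) then P i j else N i j)
        cores) := by
  set P' : ι → ι → ℕ :=
    fun i j => if (i ∈ T ∧ j ∉ T) ∨ (j ∈ T ∧ i ∉ T) then N i j else P i j with hP'
  set N' : ι → ι → ℕ :=
    fun i j => if (i ∈ T ∧ j ∉ T) ∨ (j ∈ T ∧ i ∉ T) then P i j else N i j with hN'
  have hP'symm : ∀ i j, P' i j = P' j i := fun i j => by
    simp only [hP', hPsymm i j, hNsymm i j, or_comm]
  have hN'symm : ∀ i j, N' i j = N' j i := fun i j => by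
    simp only [hN', hPsymm i j, hNsymm i j, or_comm]
  choose z hz hzmod using exists_modLinking_sub_swap P N cores
  have hcut : ∀ i ∈ T, ∀ j ∈ Tᶜ,
      modLinking P N cores i j - modLinking P' N' cores i j = z i j := by
    intro i hi j hj
    rw [← hz i j]
    simp [modLinking, linking, ccParity, hP', hN', hi, mem_compl.1 hj]
  have hsum := sum_offDiag_eq_two_mul_sum_cut
    (d := fun i j => modLinking P N cores i j - modLinking P' N' cores i j)
    (fun i j => by
      simp only [modLinking_comm hPsymm hNsymm cores i j,
        modLinking_comm hP'symm hN'symm cores i j]) T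
    (fun i j hij => by
      have hnot : ¬ ((i ∈ T ∧ j ∉ T) ∨ (j ∈ T ∧ i ∉ T)) := by tauto
      simp [modLinking, linking, ccParity, hP', hN', if_neg hnot])
  rw [sum_sub_distrib, sum_congr rfl fun i hi => sum_congr rfl (hcut i hi)] at hsum
  obtain ⟨n, hn⟩ : Even (∑ i ∈ T, ∑ j ∈ Tᶜ, z i j) := by
    rw [← ZMod.intCast_eq_zero_iff_even]
    push_cast
    simp_rw [hzmod]
    exact sum_core_cut_eq_zero hPsymm hNsymm hPdiag hNdiag hdisj hcores T
  have hnC : ∑ i ∈ T, ∑ j ∈ Tᶜ, (z i j : ℂ) = n + n := by exact_mod_cast hn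
  have hlam : 2 * lamTilde P N cores = 2 * lamTilde P' N' cores + ((4 * n : ℤ) : ℂ) := by
    rw [hnC] at hsum
    simp only [lamTilde]
    push_cast
    linear_combination hsum
  rw [hlam, Complex.cpow_add _ _ Complex.I_ne_zero, Complex.cpow_intCast, zpow_mul]
  have hI : (Complex.I : ℂ) ^ (4 : ℤ) = 1 := by exact_mod_cast Complex.I_pow_four
  rw [hI, one_zpow, mul_one]
end

section
/- In the crossing-data model with a core structure, suppose distinct components i and j satisfy p i j = 1. Let L̃k′ i j denote the modified linking number computed after reversing the orientation of component i (which replaces Lk i j by −Lk i j and leaves m i j, π i j, p i j unchanged). Then the difference L̃k i j − L̃k′ i j is an even integer: it equals 0 when m i j is odd, and equals ±(P i j − N i j), an even integer, when m i j is even. -/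
open Finset

/-- For components without a common core, the exponent of `-1` in the modified linking number is
an integer. -/
theorem modLinking_eq_zpow {ι : Type*} [DecidableEq ι] (P N : ι → ι → ℕ)
    (cores : Finset (Finset ι)) (i j : ι) (hp : compParity cores i j = 1) (e : ℤ)
    (he : (P i j : ℤ) - N i j + ccParity P N i j = 2 * e) :
    modLinking P N cores i j = (-1 : ℂ) ^ e * (((P i j : ℂ) - N i j) / 2) := by
  have he' : (P i j : ℂ) - N i j + ccParity P N i j = 2 * e := by exact_mod_cast he
  have hexp : (compParity cores i j : ℂ) * (linking P N i j + (ccParity P N i j : ℂ) / 2) = e := by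
    rw [hp, linking]
    push_cast
    linear_combination he' / 2
  rw [modLinking, hexp, Complex.cpow_intCast, linking]

/-- If `p i j = 1`, then the difference between `L̃k i j` and the modified linking
number computed after reversing the orientation of component `i` is an even integer:
it is `0` when `m i j` is odd, and is `±(P i j - N i j)`, an even integer, when
`m i j` is even. -/
theorem modLinking_reverse_diff_even {ι : Type*} [Fintype ι] [DecidableEq ι]
    (P N : ι → ι → ℕ) (cores : Finset (Finset ι))
    (hPsymm : ∀ i j, P i j = P j i) (hNsymm : ∀ i j, N i j = N j i)
    (hPdiag : ∀ i : ι, P i i = 0) (hNdiag : ∀ i : ι, N i i = 0)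
    (hdisj : ∀ C ∈ cores, ∀ C' ∈ cores, C ≠ C' → Disjoint C C')
    (hcores : ∀ C ∈ cores, ∀ i ∈ C, Even (∑ j ∈ C, mCount P N i j))
    (i j : ι) (hij : i ≠ j) (hp : compParity cores i j = 1) :
    (∃ k : ℤ,
      modLinking P N cores i j -
        modLinking (fun a b => if a = i ∨ b = i then N a b else P a b)
                   (fun a b => if a = i ∨ b = i then P a b else N a b) cores i j
        = 2 * (k : ℂ)) ∧
    (Odd (mCount P N i j) →
      modLinking P N cores i j -
        modLinking (fun a b => if a = i ∨ b = i then N a b else P a b)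
                   (fun a b => if a = i ∨ b = i then P a b else N a b) cores i j
        = 0) ∧
    (Even (mCount P N i j) →
      ((modLinking P N cores i j -
          modLinking (fun a b => if a = i ∨ b = i then N a b else P a b)
                     (fun a b => if a = i ∨ b = i then P a b else N a b) cores i j
          = ((P i j : ℂ) - (N i j : ℂ)) ∨
        modLinking P N cores i j -
          modLinking (fun a b => if a = i ∨ b = i then N a b else P a b)
                     (fun a b => if a = i ∨ b = i then P a b else N a b) cores i j
          = -((P i j : ℂ) - (N i j : ℂ))) ∧
       Even ((P i j : ℤ) - (N i j : ℤ)))) := by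
  set P' : ι → ι → ℕ := fun a b => if a = i ∨ b = i then N a b else P a b with hP'
  set N' : ι → ι → ℕ := fun a b => if a = i ∨ b = i then P a b else N a b with hN'
  have hPij : P' i j = N i j := by simp [hP']
  have hNij : N' i j = P i j := by simp [hN']
  have hodd : Odd (mCount P N i j) →
      modLinking P N cores i j - modLinking P' N' cores i j = 0 := by
    intro hm
    have hπ : ccParity P N i j = 1 := Nat.odd_iff.mp hm
    have hπ' : ccParity P' N' i j = 1 := by
      rw [ccParity, hPij, hNij, add_comm]
      exact hπ
    obtain ⟨a, ha⟩ : Odd ((P i j : ℤ) - N i j) := by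
      rw [mCount] at hm
      grind
    rw [modLinking_eq_zpow P N cores i j hp (a + 1) (by rw [hπ]; push_cast; linarith),
      modLinking_eq_zpow P' N' cores i j hp (-a) (by rw [hπ', hPij, hNij]; push_cast; linarith),
      hPij, hNij, zpow_add_one₀ (by norm_num), zpow_neg, ← inv_zpow, inv_neg_one]
    ring
  have heven : Even (mCount P N i j) → ∃ l : ℤ, (P i j : ℤ) - N i j = 2 * l ∧
      modLinking P N cores i j - modLinking P' N' cores i j =
        (-1 : ℂ) ^ l * ((P i j : ℂ) - N i j) := by
    intro hm
    have hπ : ccParity P N i j = 0 := Nat.even_iff.mp hm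
    have hπ' : ccParity P' N' i j = 0 := by
      rw [ccParity, hPij, hNij, add_comm]
      exact hπ
    obtain ⟨l, hl⟩ : ∃ l : ℤ, (P i j : ℤ) - N i j = 2 * l := by
      rw [mCount, Nat.even_iff] at hm
      exact ⟨((P i j : ℤ) - N i j) / 2, by omega⟩
    refine ⟨l, hl, ?_⟩
    rw [modLinking_eq_zpow P N cores i j hp l (by rw [hπ]; push_cast; linarith),
      modLinking_eq_zpow P' N' cores i j hp (-l) (by rw [hπ', hPij, hNij]; push_cast; linarith),
      hPij, hNij, zpow_neg, ← inv_zpow, inv_neg_one]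
    ring
  refine ⟨?_, hodd, fun hm => ?_⟩
  · rcases Nat.even_or_odd (mCount P N i j) with hm | hm
    · obtain ⟨l, hl, h⟩ := heven hm
      have hl' : (P i j : ℂ) - N i j = 2 * l := by exact_mod_cast hl
      rw [h, hl']
      rcases Int.even_or_odd l with h2 | h2
      · exact ⟨l, by rw [h2.neg_one_zpow, one_mul]⟩
      · exact ⟨-l, by rw [h2.neg_one_zpow]; push_cast; ring⟩
    · exact ⟨0, by simpa using hodd hm⟩
  · obtain ⟨l, hl, h⟩ := heven hm
    refine ⟨?_, hl ▸ even_two_mul l⟩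
    rw [h]
    rcases Int.even_or_odd l with h2 | h2
    · left; rw [h2.neg_one_zpow, one_mul]
    · right; rw [h2.neg_one_zpow, neg_one_mul]
end

section
/- In the crossing-data model, suppose the whole link is even, i.e. for every component i the total mixed-crossing count Σ_j m i j is even. Let λ = Σ over unordered pairs {i,j} of Lk i j, and let λ′ be the corresponding sum after reversing the orientation of a single component s (which replaces Lk s j by −Lk s j for all j ≠ s). Then λ − λ′ = Σ_j (P s j − N s j) is an even integer; in particular the parity of the exponent of (−1) in the normalization of the unoriented Jones polynomial of an even virtual link is unchanged by reversing the orientation of any component. -/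
open Finset

/-- The change in the linking number when component `s` is reversed, split into the
contributions of row `s` and column `s`. -/
lemma linking_sub_linking_reverse {ι : Type*} [DecidableEq ι] (P N : ι → ι → ℕ)
    (hPdiag : ∀ i : ι, P i i = 0) (hNdiag : ∀ i : ι, N i i = 0) (s i j : ι) :
    linking P N i j -
      linking (fun i j => if i = s ∨ j = s then N i j else P i j)
              (fun i j => if i = s ∨ j = s then P i j else N i j) i j =
    (if i = s then (P i j : ℂ) - N i j else 0) +
      (if j = s then (P i j : ℂ) - N i j else 0) := by
  by_cases hi : i = s <;> by_cases hj : j = s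
  · subst hi hj
    simp [linking, hPdiag, hNdiag]
  all_goals
    simp only [linking, hi, hj, or_true, or_false, if_true, if_false]
    ring

/-- A function vanishing on the diagonal has the same sum off the diagonal as over all pairs. -/
lemma sum_offDiag_univ_of_diag_eq_zero {ι M : Type*} [Fintype ι] [DecidableEq ι]
    [AddCommMonoid M] (f : ι → ι → M) (hf : ∀ i, f i i = 0) :
    ∑ p ∈ (univ : Finset ι).offDiag, f p.1 p.2 = ∑ i, ∑ j, f i j := by
  rw [← Fintype.sum_prod_type']
  refine sum_subset (subset_univ _) ?_
  rintro ⟨i, j⟩ - h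
  obtain rfl : i = j := by simpa using h
  exact hf i

/-- For an even virtual link, reversing the orientation of a single component `s`
changes `λ = Σ_{unordered pairs} Lk i j` by `Σ_j (P s j - N s j)`, which is an even
integer; in particular the parity of the exponent of `(-1)` in the normalization of
the unoriented Jones polynomial of an even virtual link is unchanged. -/
theorem lambda_reverse_component_even_link {ι : Type*} [Fintype ι] [DecidableEq ι]
    (P N : ι → ι → ℕ)
    (hPsymm : ∀ i j, P i j = P j i) (hNsymm : ∀ i j, N i j = N j i)
    (hPdiag : ∀ i : ι, P i i = 0) (hNdiag : ∀ i : ι, N i i = 0)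
    (hLinkEven : ∀ i : ι, Even (∑ j, mCount P N i j))
    (s : ι) :
    ((∑ p ∈ (univ : Finset ι).offDiag, linking P N p.1 p.2) / 2 -
      (∑ p ∈ (univ : Finset ι).offDiag,
        linking (fun i j => if i = s ∨ j = s then N i j else P i j)
                (fun i j => if i = s ∨ j = s then P i j else N i j) p.1 p.2) / 2
      = ∑ j, ((P s j : ℂ) - (N s j : ℂ))) ∧
    Even (∑ j, ((P s j : ℤ) - (N s j : ℤ))) := by
  constructor
  · rw [← sub_div, ← sum_sub_distrib]
    simp only [linking_sub_linking_reverse P N hPdiag hNdiag s]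
    rw [sum_offDiag_univ_of_diag_eq_zero (fun i j =>
      (if i = s then (P i j : ℂ) - N i j else 0) + (if j = s then (P i j : ℂ) - N i j else 0))
      (fun i => by simp [hPdiag, hNdiag])]
    simp only [sum_add_distrib]
    rw [sum_comm]
    simp only [sum_ite_eq', mem_univ, if_true, hPsymm _ s, hNsymm _ s]
    ring
  · have hsum : ∑ j, ((P s j : ℤ) - N s j) =
        ((∑ j, mCount P N s j : ℕ) : ℤ) - 2 * ∑ j, (N s j : ℤ) := by
      push_cast [mCount]
      rw [mul_sum, ← sum_sub_distrib]
      exact sum_congr rfl fun j _ => by ring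
    rw [hsum]
    exact ((Int.even_coe_nat _).mpr (hLinkEven s)).sub (even_two_mul _)
end
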